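/- If G is a connected outerplanar graph, then the fully active cop number of G is at most 2. -/

import Mathlib

open SimpleGraph

universe u v

variable {V : Type u}

/-- A configuration in the game of Cops and Robbers with `n` cops:
the positions of the cops together with the position of the robber. -/
abbrev CRConfig (V : Type u) (n : ℕ) : Type u := (Fin n → V) × V

/-- A strategy for `n` cops in the *fully active* game on `G`:
initial positions, together with a move function (which may depend on the
full history of the play and on the current configuration) under which
every cop moves to an adjacent vertex on every turn. -/
structure ActiveCopStrategy (G : SimpleGraph V) (n : ℕ) where
  init : Fin n → V
  move : List (CRConfig V n) → CRConfig V n → Fin n → V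
  move_adj : ∀ h c i, G.Adj (c.1 i) (move h c i)

/-- A strategy for the robber in the *fully active* game on `G`:
an initial position (chosen knowing the cops' initial positions),
together with a move function (which may depend on the full history and on
the current configuration, whose first component records the cops' newly
chosen positions) under which the robber moves to an adjacent vertex on
every turn. -/
structure ActiveRobberStrategy (G : SimpleGraph V) (n : ℕ) where
  init : (Fin n → V) → V
  move : List (CRConfig V n) → CRConfig V n → V
  move_adj : ∀ h c, G.Adj c.2 (move h c)

/-- A strategy for `n` cops in the *passive* (classical) game on `G`:
on her turn, each cop either moves to an adjacent vertex or stays put. -/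
structure PassiveCopStrategy (G : SimpleGraph V) (n : ℕ) where
  init : Fin n → V
  move : List (CRConfig V n) → CRConfig V n → Fin n → V
  move_adj : ∀ h c i, G.Adj (c.1 i) (move h c i) ∨ move h c i = c.1 i

/-- A strategy for the robber in the *passive* (classical) game on `G`:
on his turn the robber either moves to an adjacent vertex or stays put. -/
structure PassiveRobberStrategy (G : SimpleGraph V) (n : ℕ) where
  init : (Fin n → V) → V
  move : List (CRConfig V n) → CRConfig V n → V
  move_adj : ∀ h c, G.Adj c.2 (move h c) ∨ move h c = c.2

/-- The play determined by (the data of) a cop strategy and a robber strategy: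
`crPlay n cinit rinit cmove rmove t` is the pair consisting of the history of
configurations strictly before round `t` and the configuration after round `t`
(a round consists of a cop move followed by a robber move; round `0` is the
initial placement, cops first, then the robber). -/
def crPlay (n : ℕ) (cinit : Fin n → V) (rinit : (Fin n → V) → V)
    (cmove : List (CRConfig V n) → CRConfig V n → Fin n → V)
    (rmove : List (CRConfig V n) → CRConfig V n → V) :
    ℕ → List (CRConfig V n) × CRConfig V n
  | 0 => ([], (cinit, rinit cinit))
  | t + 1 =>
      let p := crPlay n cinit rinit cmove rmove t
      let c' := cmove p.1 p.2
      (p.1 ++ [p.2], (c', rmove p.1 (c', p.2.2)))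

/-- The cops capture the robber in the given play: at some point of the play
(either right after a robber move, or right after a cop move) some cop
occupies the robber's vertex. -/
def crCaptures (n : ℕ) (cinit : Fin n → V) (rinit : (Fin n → V) → V)
    (cmove : List (CRConfig V n) → CRConfig V n → Fin n → V)
    (rmove : List (CRConfig V n) → CRConfig V n → V) : Prop :=
  ∃ t : ℕ,
    (∃ i, (crPlay n cinit rinit cmove rmove t).2.1 i
        = (crPlay n cinit rinit cmove rmove t).2.2) ∨
    (∃ i, cmove (crPlay n cinit rinit cmove rmove t).1
            (crPlay n cinit rinit cmove rmove t).2 i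
        = (crPlay n cinit rinit cmove rmove t).2.2)

/-- In the fully active game, the given cop strategy captures the robber
playing the given strategy. -/
def ActiveCapture {G : SimpleGraph V} {n : ℕ} (cs : ActiveCopStrategy G n)
    (rs : ActiveRobberStrategy G n) : Prop :=
  crCaptures n cs.init rs.init cs.move rs.move

/-- In the passive game, the given cop strategy captures the robber
playing the given strategy. -/
def PassiveCapture {G : SimpleGraph V} {n : ℕ} (cs : PassiveCopStrategy G n)
    (rs : PassiveRobberStrategy G n) : Prop :=
  crCaptures n cs.init rs.init cs.move rs.move

/-- `n` cops have a winning strategy in the fully active game on `G`. -/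
def ActiveCopsWin (G : SimpleGraph V) (n : ℕ) : Prop :=
  ∃ cs : ActiveCopStrategy G n, ∀ rs : ActiveRobberStrategy G n, ActiveCapture cs rs

/-- `n` cops have a winning strategy in the passive (classical) game on `G`. -/
def PassiveCopsWin (G : SimpleGraph V) (n : ℕ) : Prop :=
  ∃ cs : PassiveCopStrategy G n, ∀ rs : PassiveRobberStrategy G n, PassiveCapture cs rs

/-- The fully active cop number of `G`. -/
noncomputable def acop (G : SimpleGraph V) : ℕ := sInf {n | ActiveCopsWin G n}

/-- The (classical, passive) cop number of `G`. -/
noncomputable def copNumber (G : SimpleGraph V) : ℕ := sInf {n | PassiveCopsWin G n}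
/-- `H` is a minor of `G`: there are pairwise disjoint connected branch sets
in `G`, one for each vertex of `H`, such that whenever two vertices are
adjacent in `H`, some edge of `G` joins the corresponding branch sets. -/
def HasMinor {W : Type v} (G : SimpleGraph V) (H : SimpleGraph W) : Prop :=
  ∃ B : W → Set V,
    (∀ w, (G.induce (B w)).Connected) ∧
    (Pairwise fun w₁ w₂ => Disjoint (B w₁) (B w₂)) ∧
    (∀ w₁ w₂, H.Adj w₁ w₂ → ∃ a ∈ B w₁, ∃ b ∈ B w₂, G.Adj a b)

/-- A graph is outerplanar iff it has no `K₄` minor and no `K_{2,3}` minor. -/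
def Outerplanar (G : SimpleGraph V) : Prop :=
  ¬ HasMinor G (completeGraph (Fin 4)) ∧
  ¬ HasMinor G (completeBipartiteGraph (Fin 2) (Fin 3))

section Helpers

/-- reachability inside a set -/
def RIn (G : SimpleGraph V) (S : Set V) : V → V → Prop :=
  Relation.ReflTransGen (fun u v => G.Adj u v ∧ u ∈ S ∧ v ∈ S)

theorem RIn.symm {G : SimpleGraph V} {S : Set V} {x y : V} (h : RIn G S x y) : RIn G S y x := by
  induction h with
  | refl => exact Relation.ReflTransGen.refl
  | tail _ h ih => exact Relation.ReflTransGen.head ⟨h.1.symm, h.2.2, h.2.1⟩ ih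

theorem RIn.mono {G : SimpleGraph V} {S T : Set V} (hST : S ⊆ T) {x y : V}
    (h : RIn G S x y) : RIn G T x y :=
  Relation.ReflTransGen.mono (fun _ _ h => ⟨h.1, hST h.2.1, hST h.2.2⟩) _ _ h

theorem RIn.exit {G : SimpleGraph V} {S X : Set V} {x y : V} (h : RIn G S x y)
    (hx : x ∈ X) (hy : y ∉ X) : ∃ u ∈ X, ∃ v, v ∉ X ∧ v ∈ S ∧ u ∈ S ∧ G.Adj u v := by
  induction h with
  | refl => exact absurd hx hy
  | @tail b c _ h ih =>
    by_cases hb : b ∈ X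
    · exact ⟨b, hb, c, hy, h.2.2, h.2.1, h.1⟩
    · exact ih hb

/-- connected set -/
def Cn (G : SimpleGraph V) (S : Set V) : Prop :=
  S.Nonempty ∧ ∀ x ∈ S, ∀ y ∈ S, RIn G S x y

/-- component of `r` in `S` -/
def cmpt (G : SimpleGraph V) (S : Set V) (r : V) : Set V := {x | RIn G S r x}

theorem cmpt_self (G : SimpleGraph V) (S : Set V) (r : V) : r ∈ cmpt G S r :=
  Relation.ReflTransGen.refl

theorem cmpt_subset {G : SimpleGraph V} {S : Set V} {r : V} (hr : r ∈ S) : cmpt G S r ⊆ S := by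
  intro x hx
  rcases Relation.ReflTransGen.cases_tail hx with h | ⟨c, _, h⟩
  · exact h ▸ hr
  · exact h.2.2

theorem cmpt_step {G : SimpleGraph V} {S : Set V} {r x y : V} (hr : r ∈ S)
    (hx : x ∈ cmpt G S r) (hxy : G.Adj x y) (hy : y ∈ S) : y ∈ cmpt G S r :=
  Relation.ReflTransGen.tail hx ⟨hxy, cmpt_subset hr hx, hy⟩

theorem cmpt_Cn {G : SimpleGraph V} {S : Set V} {r : V} : Cn G (cmpt G S r) := by
  have key : ∀ x ∈ cmpt G S r, RIn G (cmpt G S r) r x := by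
    intro x hx
    have hx' : RIn G S r x := hx
    clear hx
    induction hx' with
    | refl => exact Relation.ReflTransGen.refl
    | tail h1 h ih => exact Relation.ReflTransGen.tail ih ⟨h.1, h1, Relation.ReflTransGen.tail h1 h⟩
  exact ⟨⟨r, cmpt_self G S r⟩, fun x hx y hy => (key x hx).symm.trans (key y hy)⟩

theorem Cn.subset_cmpt {G : SimpleGraph V} {S T : Set V} {r x : V} (hT : Cn G T) (hTS : T ⊆ S)
    (hx : x ∈ T) (hxr : x ∈ cmpt G S r) : T ⊆ cmpt G S r := by
  intro y hy
  exact Relation.ReflTransGen.trans hxr (RIn.mono hTS (hT.2 x hx y hy))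

theorem Cn_singleton (G : SimpleGraph V) (x : V) : Cn G {x} := by
  refine ⟨⟨x, rfl⟩, ?_⟩
  rintro y rfl z rfl
  exact Relation.ReflTransGen.refl

theorem Cn.ins {G : SimpleGraph V} {S : Set V} {x y : V} (hS : Cn G S) (hy : y ∈ S)
    (hxy : G.Adj x y) : Cn G (insert x S) := by
  have key : ∀ z ∈ insert x S, RIn G (insert x S) y z := by
    intro z hz
    rcases hz with rfl | hz
    · exact Relation.ReflTransGen.single ⟨hxy.symm, Or.inr hy, Or.inl rfl⟩
    · exact (hS.2 y hy z hz).mono (Set.subset_insert _ _)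
  exact ⟨⟨x, Or.inl rfl⟩, fun u hu v hv => (key u hu).symm.trans (key v hv)⟩

theorem Cn.connected {G : SimpleGraph V} {S : Set V} (hS : Cn G S) :
    (G.induce S).Connected := by
  have key : ∀ x y (hx : x ∈ S) (hy : y ∈ S), RIn G S x y →
      (G.induce S).Reachable ⟨x, hx⟩ ⟨y, hy⟩ := by
    intro x y hx hy h
    induction h with
    | refl => exact SimpleGraph.Reachable.refl _
    | tail _ h ih =>
      refine (ih h.2.1).trans (SimpleGraph.Adj.reachable ?_)
      exact h.1
  have : Nonempty S := hS.1.to_subtype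
  exact ⟨fun x y => key x.1 y.1 x.2 y.2 (hS.2 x.1 x.2 y.1 y.2)⟩

/-- two sets joined by an edge -/
def Touch (G : SimpleGraph V) (S T : Set V) : Prop := ∃ a ∈ S, ∃ b ∈ T, G.Adj a b

theorem Touch.symm {G : SimpleGraph V} {S T : Set V} (h : Touch G S T) : Touch G T S := by
  obtain ⟨a, ha, b, hb, h⟩ := h
  exact ⟨b, hb, a, ha, h.symm⟩

theorem K4_minor {G : SimpleGraph V} {A B C D : Set V} (hA : Cn G A) (hB : Cn G B)
    (hC : Cn G C) (hD : Cn G D) (dAB : Disjoint A B) (dAC : Disjoint A C) (dAD : Disjoint A D)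
    (dBC : Disjoint B C) (dBD : Disjoint B D) (dCD : Disjoint C D)
    (tAB : Touch G A B) (tAC : Touch G A C) (tAD : Touch G A D)
    (tBC : Touch G B C) (tBD : Touch G B D) (tCD : Touch G C D) :
    HasMinor G (completeGraph (Fin 4)) := by
  refine ⟨![A, B, C, D], ?_, ?_, ?_⟩
  · intro i
    fin_cases i
    exacts [hA.connected, hB.connected, hC.connected, hD.connected]
  · intro i j hij
    fin_cases i <;> fin_cases j <;>
      first
      | exact absurd rfl hij
      | assumption
      | (apply Disjoint.symm; assumption)
  · intro i j hij
    have hij' : i ≠ j := hij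
    clear hij
    change Touch G _ _
    fin_cases i <;> fin_cases j <;>
      first
      | exact absurd rfl hij'
      | assumption
      | (apply Touch.symm; assumption)

theorem K23_minor {G : SimpleGraph V} {A B C D E : Set V} (hA : Cn G A) (hB : Cn G B)
    (hC : Cn G C) (hD : Cn G D) (hE : Cn G E)
    (dAB : Disjoint A B) (dAC : Disjoint A C) (dAD : Disjoint A D) (dAE : Disjoint A E)
    (dBC : Disjoint B C) (dBD : Disjoint B D) (dBE : Disjoint B E)
    (dCD : Disjoint C D) (dCE : Disjoint C E) (dDE : Disjoint D E)
    (tAC : Touch G A C) (tAD : Touch G A D) (tAE : Touch G A E)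
    (tBC : Touch G B C) (tBD : Touch G B D) (tBE : Touch G B E) :
    HasMinor G (completeBipartiteGraph (Fin 2) (Fin 3)) := by
  refine ⟨Sum.elim ![A, B] ![C, D, E], ?_, ?_, ?_⟩
  · rintro (i | i) <;> fin_cases i
    exacts [hA.connected, hB.connected, hC.connected, hD.connected, hE.connected]
  · rintro (i | i) (j | j) hij <;> fin_cases i <;> fin_cases j <;>
      first
      | exact absurd rfl hij
      | assumption
      | (apply Disjoint.symm; assumption)
  · rintro (i | i) (j | j) hij
    · simp at hij
    · change Touch G _ _
      fin_cases i <;> fin_cases j <;> assumption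
    · change Touch G _ _
      apply Touch.symm
      fin_cases i <;> fin_cases j <;> assumption
    · simp at hij

/-- The minor-extraction core. -/
theorem no_pair {G : SimpleGraph V} (hout : Outerplanar G) {K A : Set V} {a b w w2 : V}
    (hK : Cn G K) (hA : Cn G A) (haA : a ∈ A) (hbA : b ∉ A) (hAK : Disjoint A K)
    (hbK : b ∉ K) (hAb : ∃ a' ∈ A, G.Adj a' b)
    (hw : w ∈ K) (hw2 : w2 ∈ K) (hne : w ≠ w2) (haw : G.Adj a w) (haw2 : G.Adj a w2)
    (h1 : ∃ x, RIn G (K \ {w}) w2 x ∧ G.Adj x b)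
    (h2 : ∃ x, RIn G (K \ {w2}) w x ∧ G.Adj x b) : False := by
  have hAK' : ∀ x ∈ A, x ∉ K := fun x hx hk => Set.disjoint_left.1 hAK hx hk
  have hbw : b ≠ w := fun h => hbK (h ▸ hw)
  have hbw2 : b ≠ w2 := fun h => hbK (h ▸ hw2)
  set H : Set V := insert b K \ {w, w2} with hH
  have hbH : b ∈ H := ⟨Or.inl rfl, by simp [hbw, hbw2]⟩
  set X := cmpt G H b with hX
  have hXH : X ⊆ H := cmpt_subset hbH
  have hXw : w ∉ X := fun h => (hXH h).2 (by simp)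
  have hXw2 : w2 ∉ X := fun h => (hXH h).2 (by simp)
  have t2 : Touch G X {w2} := by
    obtain ⟨x, hx, hxb⟩ := h1
    have hxK : x ∈ K \ {w} := cmpt_subset (G := G) (S := K \ {w}) (r := w2) ⟨hw2, hne.symm⟩ hx
    have hr : RIn G (insert b K \ {w}) b w2 :=
      Relation.ReflTransGen.head ⟨hxb.symm, ⟨Or.inl rfl, hbw⟩, ⟨Or.inr hxK.1, hxK.2⟩⟩
        (hx.symm.mono (by intro z hz; exact ⟨Or.inr hz.1, hz.2⟩))
    obtain ⟨u, hu, v, hv, hvS, _, huv⟩ := hr.exit (cmpt_self G H b) hXw2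
    have : v = w2 := by
      by_contra hvw
      refine hv (cmpt_step hbH hu huv ⟨hvS.1, ?_⟩)
      rintro (h | h)
      · exact hvS.2 h
      · exact hvw h
    exact ⟨u, hu, v, this, huv⟩
  have t1 : Touch G X {w} := by
    obtain ⟨x, hx, hxb⟩ := h2
    have hxK : x ∈ K \ {w2} := cmpt_subset (G := G) (S := K \ {w2}) (r := w) ⟨hw, hne⟩ hx
    have hr : RIn G (insert b K \ {w2}) b w :=
      Relation.ReflTransGen.head ⟨hxb.symm, ⟨Or.inl rfl, hbw2⟩, ⟨Or.inr hxK.1, hxK.2⟩⟩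
        (hx.symm.mono (by intro z hz; exact ⟨Or.inr hz.1, hz.2⟩))
    obtain ⟨u, hu, v, hv, hvS, _, huv⟩ := hr.exit (cmpt_self G H b) hXw
    have : v = w := by
      by_contra hvw
      refine hv (cmpt_step hbH hu huv ⟨hvS.1, ?_⟩)
      rintro (h | h)
      · exact hvw h
      · exact hvS.2 h
    exact ⟨u, hu, v, this, huv⟩
  have dAX : Disjoint A X := by
    rw [Set.disjoint_left]
    intro z hz hzX
    rcases (hXH hzX).1 with rfl | h
    · exact hbA hz
    · exact hAK' z hz h
  have tAX : Touch G A X := by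
    obtain ⟨a', ha', h⟩ := hAb
    exact ⟨a', ha', b, cmpt_self G H b, h⟩
  -- the K4 finisher
  have fin4 : ∀ E : Set V, Cn G E → E ⊆ K → Disjoint X E → w ∉ E → w2 ∈ E →
      Touch G {w} E → False := by
    intro E hE hEK hXE hwE hw2E hwt
    apply hout.1
    refine K4_minor hA (cmpt_Cn (G := G) (S := H) (r := b)) (Cn_singleton G w) hE dAX ?_ ?_ ?_ hXE
      ?_ tAX ⟨a, haA, w, rfl, haw⟩ ⟨a, haA, w2, hw2E, haw2⟩ t1 ?_ hwt
    · rw [Set.disjoint_singleton_right]; exact fun h => hAK' w h hw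
    · exact hAK.mono_right hEK
    · rw [Set.disjoint_singleton_right]; exact hXw
    · rw [Set.disjoint_singleton_left]; exact hwE
    · obtain ⟨u, hu, v, hv, h⟩ := t2
      rw [Set.mem_singleton_iff] at hv
      subst hv
      exact ⟨u, hu, v, hw2E, h⟩
  -- neighbour of w2 connected to w
  have hwS : w ∈ K \ {w2} := ⟨hw, hne⟩
  obtain ⟨y, hy, v, hv, hvK, hyK, hyv⟩ := (hK.2 w hw w2 hw2).exit (cmpt_self G (K \ {w2}) w)
    (fun h => (cmpt_subset hwS h).2 rfl)
  have hvw2 : v = w2 := by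
    by_contra h
    exact hv (cmpt_step hwS hy hyv ⟨hvK, h⟩)
  subst hvw2
  by_cases hyw : y = w
  · subst hyw
    refine fin4 {v} (Cn_singleton G v) (by simpa using hw2) ?_ (by simpa using hne) rfl
      ⟨y, rfl, v, rfl, hyv⟩
    rw [Set.disjoint_singleton_right]; exact hXw2
  have hyS : y ∈ K \ {w, v} := by
    refine ⟨hyK, ?_⟩
    rintro (h | h)
    · exact hyw h
    · exact (cmpt_subset hwS hy).2 h
  set D := cmpt G (K \ {w, v}) y with hD
  have hDK : D ⊆ K \ {w, v} := cmpt_subset hyS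
  have hDw : w ∉ D := fun h => (hDK h).2 (by simp)
  have hDv : v ∉ D := fun h => (hDK h).2 (by simp)
  have tDw : Touch G D {w} := by
    have hr : RIn G (K \ {v}) y w := RIn.symm hy
    obtain ⟨u, hu, z, hz, hzS, _, huz⟩ := hr.exit (cmpt_self G (K \ {w, v}) y) hDw
    have : z = w := by
      by_contra hzw
      refine hz (cmpt_step hyS hu huz ⟨hzS.1, ?_⟩)
      rintro (h | h)
      · exact hzw h
      · exact hzS.2 h
    exact ⟨u, hu, z, this, huz⟩
  have hDc : Cn G D := cmpt_Cn
  by_cases hDb : ∃ d ∈ D, G.Adj d b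
  · apply hout.2
    obtain ⟨d, hd, hdb⟩ := hDb
    obtain ⟨a', ha', hab⟩ := hAb
    refine K23_minor hDc hA (Cn_singleton G w) (Cn_singleton G v) (Cn_singleton G b)
      ?_ ?_ ?_ ?_ ?_ ?_ ?_ ?_ ?_ ?_ tDw ⟨y, cmpt_self _ _ _, v, rfl, hyv⟩ ⟨d, hd, b, rfl, hdb⟩
      ⟨a, haA, w, rfl, haw⟩ ⟨a, haA, v, rfl, haw2⟩ ⟨a', ha', b, rfl, hab⟩
    · exact (hAK.mono_right (fun z hz => (hDK hz).1)).symm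
    · rw [Set.disjoint_singleton_right]; exact hDw
    · rw [Set.disjoint_singleton_right]; exact hDv
    · rw [Set.disjoint_singleton_right]; exact fun h => hbK (hDK h).1
    · rw [Set.disjoint_singleton_right]; exact fun h => hAK' w h hw
    · rw [Set.disjoint_singleton_right]; exact fun h => hAK' v h hw2
    · rw [Set.disjoint_singleton_right]; exact hbA
    · simpa using hne
    · simpa using hbw.symm
    · simpa using hbw2.symm
  · refine fin4 (insert v D) (hDc.ins (cmpt_self _ _ _) hyv.symm) ?_ ?_ ?_ (Or.inl rfl) ?_
    · rintro z (rfl | hz)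
      · exact hw2
      · exact (hDK hz).1
    · rw [Set.disjoint_left]
      rintro z hzX (rfl | hzD)
      · exact hXw2 hzX
      · obtain ⟨u, hu, t, ht, htS, _, hut⟩ := (RIn.symm hzX).exit hzD (fun h => hbK (hDK h).1)
        rcases htS.1 with rfl | htK
        · exact hDb ⟨u, hu, hut⟩
        · exact ht (cmpt_step hyS hu hut ⟨htK, htS.2⟩)
    · rintro (h | h)
      · exact hne h
      · exact hDw h
    · obtain ⟨u, hu, z, hz, h⟩ := tDw
      exact ⟨z, hz, u, Or.inr hu, h.symm⟩

theorem exists_good [Finite V] {G : SimpleGraph V} (hout : Outerplanar G) {K A : Set V} {a b : V}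
    (hK : Cn G K) (hA : Cn G A) (haA : a ∈ A) (hbA : b ∉ A) (hAK : Disjoint A K)
    (hbK : b ∉ K) (hAb : ∃ a' ∈ A, G.Adj a' b) (haK : ∃ w ∈ K, G.Adj a w) :
    ∃ w ∈ K, G.Adj a w ∧ ∀ r ∈ K, r ≠ w →
      (∀ x ∈ cmpt G (K \ {w}) r, ¬ G.Adj x a) ∨ (∀ x ∈ cmpt G (K \ {w}) r, ¬ G.Adj x b) := by
  by_contra hcon
  push Not at hcon
  have key : ∀ C : Set V, ∀ w ∈ K, G.Adj a w → ∀ r ∈ K, r ≠ w → C = cmpt G (K \ {w}) r →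
      (∃ x ∈ C, G.Adj x a) → (∃ x ∈ C, G.Adj x b) → False := by
    intro C
    induction C using WellFoundedLT.induction with
    | ind C ih =>
    intro w hw haw r hr hrw hC hCa hCb
    obtain ⟨w2, hw2C, hw2a⟩ := hCa
    have hrS : r ∈ K \ {w} := ⟨hr, hrw⟩
    have hCS : C ⊆ K \ {w} := hC ▸ cmpt_subset hrS
    have hw2 : w2 ∈ K := (hCS hw2C).1
    have hne : w ≠ w2 := fun h => (hCS hw2C).2 h.symm
    obtain ⟨r2, hr2, hr2w, hA2, hB2⟩ := hcon w2 hw2 hw2a.symm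
    have hr2S : r2 ∈ K \ {w2} := ⟨hr2, hr2w⟩
    by_cases hwC2 : w ∈ cmpt G (K \ {w2}) r2
    · obtain ⟨x, hx, hxb⟩ := hCb
      obtain ⟨x2, hx2, hx2b⟩ := hB2
      rw [hC] at hx hw2C
      exact no_pair hout hK hA haA hbA hAK hbK hAb hw hw2 hne haw hw2a.symm
        ⟨x, (RIn.symm hw2C).trans hx, hxb⟩ ⟨x2, (RIn.symm hwC2).trans hx2, hx2b⟩
    · have hw2n : w2 ∉ cmpt G (K \ {w2}) r2 := fun h => (cmpt_subset hr2S h).2 rfl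
      obtain ⟨u, hu, v, hv, hvK, _, huv⟩ := (hK.2 r2 hr2 w2 hw2).exit
        (cmpt_self G (K \ {w2}) r2) hw2n
      have hvw : v = w2 := by
        by_contra h
        exact hv (cmpt_step hr2S hu huv ⟨hvK, h⟩)
      subst hvw
      have hsub : cmpt G (K \ {v}) r2 ⊆ K \ {w} := by
        intro z hz
        exact ⟨(cmpt_subset hr2S hz).1, fun h => hwC2 (h ▸ hz)⟩
      have huC : u ∈ C := by
        rw [hC] at hw2C ⊢
        exact cmpt_step hrS hw2C huv.symm (hsub hu)
      have hlt : cmpt G (K \ {v}) r2 < C := by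
        refine lt_of_le_of_ne ?_ ?_
        · have := Cn.subset_cmpt (cmpt_Cn (G := G) (S := K \ {v}) (r := r2)) hsub hu (hC ▸ huC)
          rw [hC]; exact this
        · intro h
          rw [h] at hw2n
          exact hw2n hw2C
      exact ih _ hlt v hw2 hw2a.symm r2 hr2 hr2w rfl hA2 hB2
  obtain ⟨w, hw, haw⟩ := haK
  obtain ⟨r, hr, hrw, h1, h2⟩ := hcon w hw haw
  exact key _ w hw haw r hr hrw rfl h1 h2

/-- Cops (to move) win within `n` rounds. -/
def WinIn (G : SimpleGraph V) : ℕ → V → V → V → Prop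
  | 0, a, b, r => a = r ∨ b = r
  | n + 1, a, b, r => WinIn G n a b r ∨ ∃ a' b', G.Adj a a' ∧ G.Adj b b' ∧
      (a' = r ∨ b' = r ∨ ∀ r', G.Adj r r' → WinIn G n a' b' r')

/-- Cops (to move) win. -/
def Win (G : SimpleGraph V) (a b r : V) : Prop := ∃ n, WinIn G n a b r

theorem WinIn.mono {G : SimpleGraph V} {m n : ℕ} (h : m ≤ n) {a b r : V}
    (hw : WinIn G m a b r) : WinIn G n a b r := by
  induction h with
  | refl => exact hw
  | step _ ih => exact Or.inl ih

theorem Win.step [Finite V] {G : SimpleGraph V} {a b r a' b' : V} (ha : G.Adj a a')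
    (hb : G.Adj b b') (h : a' = r ∨ b' = r ∨ ∀ r', G.Adj r r' → Win G a' b' r') :
    Win G a b r := by
  rcases h with h | h | h
  · exact ⟨1, Or.inr ⟨a', b', ha, hb, Or.inl h⟩⟩
  · exact ⟨1, Or.inr ⟨a', b', ha, hb, Or.inr (Or.inl h)⟩⟩
  · cases nonempty_fintype V
    classical
    choose! f hf using h
    refine ⟨Finset.univ.sup f + 1, Or.inr ⟨a', b', ha, hb, Or.inr (Or.inr ?_)⟩⟩
    intro r' hr'
    exact (hf r' hr').mono (Finset.le_sup (Finset.mem_univ r'))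

theorem WinIn.swap {G : SimpleGraph V} {n : ℕ} : ∀ {a b r : V}, WinIn G n a b r →
    WinIn G n b a r := by
  induction n with
  | zero => intro a b r h; exact Or.symm h
  | succ n ih =>
    rintro a b r (h | ⟨a', b', ha, hb, h⟩)
    · exact Or.inl (ih h)
    · refine Or.inr ⟨b', a', hb, ha, ?_⟩
      rcases h with h | h | h
      · exact Or.inr (Or.inl h)
      · exact Or.inl h
      · exact Or.inr (Or.inr fun r' hr' => ih (h r' hr'))

/-- the cop at `c` guards `x` -/
def Grd (G : SimpleGraph V) (c x : V) : Prop := c = x ∨ G.Adj c x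

theorem Grd.next {G : SimpleGraph V} (hnb : ∀ v, ∃ u, G.Adj v u) {c x : V} (h : Grd G c x) :
    ∃ c', G.Adj c c' ∧ Grd G c' x := by
  rcases h with rfl | h
  · obtain ⟨u, hu⟩ := hnb c
    exact ⟨u, hu, Or.inr hu.symm⟩
  · exact ⟨x, h, Or.inl rfl⟩

theorem Grd.win1 [Finite V] {G : SimpleGraph V} (hnb : ∀ v, ∃ u, G.Adj v u) {c x d : V}
    (h : Grd G c x) : Win G c d x := by
  rcases h with rfl | h
  · exact ⟨0, Or.inl rfl⟩
  · obtain ⟨u, hu⟩ := hnb d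
    exact Win.step h hu (Or.inl rfl)

theorem Win.swap {G : SimpleGraph V} {a b r : V} (h : Win G a b r) : Win G b a r :=
  let ⟨n, hn⟩ := h
  ⟨n, hn.swap⟩

theorem Grd.win2 [Finite V] {G : SimpleGraph V} (hnb : ∀ v, ∃ u, G.Adj v u) {c x d : V}
    (h : Grd G c x) : Win G d c x := (h.win1 hnb).swap

/-- one cop holds the edge `pq`, the other cop walks to `q` -/
theorem win_edge [Finite V] {G : SimpleGraph V} (hnb : ∀ v, ∃ u, G.Adj v u)
    {K : Set V} {p q : V} (hpq : G.Adj p q)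
    (hN : ∀ x ∈ K, ∀ y, G.Adj x y → y ∈ K ∨ y = p ∨ y = q)
    (hII : ∀ c1 c2 r, r ∈ K → Grd G c1 p → Grd G c2 q → Win G c1 c2 r)
    {c2 : V} (W : G.Walk c2 q) :
    ∀ c1 r, (c1 = p ∨ c1 = q) → r ∈ K → Win G c1 c2 r := by
  induction W with
  | nil =>
    intro c1 r hc hr
    refine hII c1 _ r hr ?_ (Or.inl rfl)
    rcases hc with rfl | rfl
    · exact Or.inl rfl
    · exact Or.inr hpq.symm
  | @cons c2 d q hcd W ih =>
    intro c1 r hc hr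
    have ih := ih hpq hN hII
    obtain ⟨c1', h1, hc1'⟩ : ∃ c1', G.Adj c1 c1' ∧ (c1' = p ∨ c1' = q) := by
      rcases hc with rfl | rfl
      · exact ⟨q, hpq, Or.inr rfl⟩
      · exact ⟨p, hpq.symm, Or.inl rfl⟩
    refine Win.step h1 hcd (Or.inr (Or.inr ?_))
    intro r' hr'
    have gp : Grd G c1' p := by
      rcases hc1' with rfl | rfl
      · exact Or.inl rfl
      · exact Or.inr hpq.symm
    have gq : Grd G c1' q := by
      rcases hc1' with rfl | rfl
      · exact Or.inr hpq
      · exact Or.inl rfl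
    rcases hN r hr r' hr' with h | rfl | rfl
    · exact ih c1' r' hc1' h
    · exact gp.win1 hnb
    · exact gq.win1 hnb

theorem win_main [Finite V] {G : SimpleGraph V} (hconn : G.Connected) (hout : Outerplanar G)
    (hnb : ∀ v, ∃ u, G.Adj v u) (K : Set V) :
    ∀ (A : Set V) (a b : V), Cn G K → Cn G A → a ∈ A → b ∉ A → Disjoint A K → b ∉ K →
      (∃ a' ∈ A, G.Adj a' b) → (∃ w ∈ K, G.Adj a w) →
      (∀ x ∈ K, ∀ y, G.Adj x y → y ∈ K ∨ y = a ∨ y = b) →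
      ∀ c1 c2 r, r ∈ K → Grd G c1 a → Grd G c2 b → Win G c1 c2 r := by
  induction K using WellFoundedLT.induction with
  | ind K ih =>
  intro A a b hK hA haA hbA hAK hbK hAb haK hN
  have haK' : a ∉ K := fun h => Set.disjoint_left.1 hAK haA h
  have core : ∀ c2 r, r ∈ K → Grd G c2 b → Win G a c2 r := by
    intro c2 r hr hc2
    obtain ⟨w, hw, haw, hgood⟩ := exists_good hout hK hA haA hbA hAK hbK hAb haK
    obtain ⟨c2', h2, hc2'⟩ := hc2.next hnb
    refine Win.step haw h2 ?_
    by_cases hrw : r = w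
    · exact Or.inl hrw.symm
    refine Or.inr (Or.inr ?_)
    intro r' hr'
    have hrS : r ∈ K \ {w} := ⟨hr, hrw⟩
    have hg := hgood r hr hrw
    set K' := cmpt G (K \ {w}) r with hK'
    have hK'S : K' ⊆ K \ {w} := cmpt_subset hrS
    have hwK' : w ∉ K' := fun h => (hK'S h).2 rfl
    have hlt : K' < K := by
      refine lt_of_le_of_ne (fun z hz => (hK'S hz).1) ?_
      intro h
      exact hwK' (h ▸ hw)
    have hN' : ∀ x ∈ K', ∀ y, G.Adj x y → y ∈ K' ∨ y = w ∨ y = a ∨ y = b := by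
      intro x hx y hxy
      by_cases hyw : y = w
      · exact Or.inr (Or.inl hyw)
      · rcases hN x (hK'S hx).1 y hxy with h | h
        · exact Or.inl (cmpt_step hrS hx hxy ⟨h, hyw⟩)
        · exact Or.inr (Or.inr h)
    have hwadj : ∃ z ∈ K', G.Adj w z := by
      obtain ⟨u, hu, v, hv, hvK, _, huv⟩ := (hK.2 r hr w hw).exit
        (cmpt_self G (K \ {w}) r) hwK'
      have hvw : v = w := by
        by_contra h
        exact hv (cmpt_step hrS hu huv ⟨hvK, h⟩)
      exact ⟨u, hu, hvw ▸ huv.symm⟩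
    rcases hN' r (cmpt_self _ _ _) r' hr' with h | rfl | rfl | rfl
    · rcases hg with hg | hg
      · -- not adjacent to a
        refine ih K' hlt (insert w A) w b cmpt_Cn (hA.ins haA haw.symm) (Or.inl rfl) ?_ ?_
          (fun hb => hbK (hK'S hb).1) ?_ hwadj ?_ w c2' r' h (Or.inl rfl) hc2'
        · rintro (rfl | hb)
          · exact hbK hw
          · exact hbA hb
        · rw [Set.disjoint_left]
          rintro z (rfl | hz) hz'
          · exact hwK' hz'
          · exact Set.disjoint_left.1 hAK hz (hK'S hz').1
        · obtain ⟨a', ha', h'⟩ := hAb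
          exact ⟨a', Or.inr ha', h'⟩
        · intro x hx y hxy
          rcases hN' x hx y hxy with h | h | h | h
          · exact Or.inl h
          · exact Or.inr (Or.inl h)
          · exact absurd (h ▸ hxy) (hg x hx)
          · exact Or.inr (Or.inr h)
      · have hNe : ∀ x ∈ K', ∀ y, G.Adj x y → y ∈ K' ∨ y = w ∨ y = a := by
          intro x hx y hxy
          rcases hN' x hx y hxy with h | h | h | h
          · exact Or.inl h
          · exact Or.inr (Or.inl h)
          · exact Or.inr (Or.inr h)
          · exact absurd (h ▸ hxy) (hg x hx)
        obtain ⟨W⟩ := hconn.preconnected c2' a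
        refine win_edge hnb haw.symm hNe ?_ W w r' (Or.inl rfl) h
        refine ih K' hlt {w} w a cmpt_Cn (Cn_singleton G w) rfl ?_ ?_
          (fun hb => haK' (hK'S hb).1) ⟨w, rfl, haw.symm⟩ hwadj hNe
        · exact haw.ne
        · rw [Set.disjoint_singleton_left]; exact hwK'
    · exact ⟨0, Or.inl rfl⟩
    · exact Grd.win1 hnb (Or.inr haw.symm)
    · exact hc2'.win2 hnb
  intro c1 c2 r hr h1 h2
  rcases h1 with rfl | h1
  · exact core c2 r hr h2
  · obtain ⟨c2', h, hc2'⟩ := h2.next hnb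
    refine Win.step h1 h (Or.inr (Or.inr ?_))
    intro r' hr'
    rcases hN r hr r' hr' with h | rfl | rfl
    · exact core c2' r' h hc2'
    · exact ⟨0, Or.inl rfl⟩
    · exact hc2'.win2 hnb

theorem win_init [Finite V] {G : SimpleGraph V} (hconn : G.Connected) (hout : Outerplanar G)
    (hnb : ∀ v, ∃ u, G.Adj v u) {p q : V} (hpq : G.Adj p q) (r : V) : Win G p q r := by
  by_cases hp : p = r
  · exact ⟨0, Or.inl hp⟩
  by_cases hq : q = r
  · exact ⟨0, Or.inr hq⟩
  have hrS : r ∈ ({p, q}ᶜ : Set V) := by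
    rintro (h | h)
    · exact hp h.symm
    · exact hq h.symm
  set K := cmpt G ({p, q}ᶜ) r with hKdef
  have hKS : K ⊆ {p, q}ᶜ := cmpt_subset hrS
  have hpK : p ∉ K := fun h => hKS h (by simp)
  have hqK : q ∉ K := fun h => hKS h (by simp)
  have hN : ∀ x ∈ K, ∀ y, G.Adj x y → y ∈ K ∨ y = p ∨ y = q := by
    intro x hx y hxy
    by_cases hy : y = p ∨ y = q
    · exact Or.inr hy
    · exact Or.inl (cmpt_step hrS hx hxy hy)
  have hreach : RIn G Set.univ r p := by
    obtain ⟨W⟩ := hconn.preconnected r p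
    clear_value K
    clear hKS hpK hqK hN hrS hp hq hKdef hpq
    induction W with
    | nil => exact Relation.ReflTransGen.refl
    | cons h _ ih => exact Relation.ReflTransGen.head ⟨h, trivial, trivial⟩ ih
  obtain ⟨u, hu, v, hv, _, _, huv⟩ := hreach.exit (cmpt_self G ({p, q}ᶜ) r) hpK
  rcases hN u hu v huv with h | rfl | rfl
  · exact absurd h hv
  · exact win_main hconn hout hnb K {v} v q cmpt_Cn (Cn_singleton G v) rfl hpq.ne'
      (by rw [Set.disjoint_singleton_left]; exact hpK) hqK ⟨v, rfl, hpq⟩ ⟨u, hu, huv.symm⟩ hN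
      v q r (cmpt_self _ _ _) (Or.inl rfl) (Or.inl rfl)
  · exact (win_main hconn hout hnb K {v} v p cmpt_Cn (Cn_singleton G v) rfl hpq.ne
      (by rw [Set.disjoint_singleton_left]; exact hqK) hpK ⟨v, rfl, hpq.symm⟩ ⟨u, hu, huv.symm⟩
      (fun x hx y hxy => (hN x hx y hxy).imp_right Or.symm)
      v p r (cmpt_self _ _ _) (Or.inl rfl) (Or.inl rfl)).swap

theorem exists_move {G : SimpleGraph V} (hnb : ∀ v, ∃ u, G.Adj v u) (a b r : V) :
    ∃ m : V × V, G.Adj a m.1 ∧ G.Adj b m.2 ∧ ∀ n, WinIn G n a b r →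
      (a = r ∨ b = r) ∨ (m.1 = r ∨ m.2 = r) ∨
        ∀ r', G.Adj r r' → ∃ k < n, WinIn G k m.1 m.2 r' := by
  classical
  obtain ⟨u, hu⟩ := hnb a
  obtain ⟨v, hv⟩ := hnb b
  by_cases h : ∃ n, WinIn G n a b r
  · obtain ⟨n, hn, hmin⟩ : ∃ n, WinIn G n a b r ∧ ∀ m < n, ¬ WinIn G m a b r :=
      ⟨Nat.find h, Nat.find_spec h, fun m hm => Nat.find_min h hm⟩
    cases n with
    | zero => exact ⟨(u, v), hu, hv, fun _ _ => Or.inl hn⟩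
    | succ n =>
      rcases hn with hn | ⟨a', b', ha, hb, h'⟩
      · exact absurd hn (hmin n (Nat.lt_succ_self n))
      · refine ⟨(a', b'), ha, hb, fun m hm => Or.inr ?_⟩
        have hnm : n < m := by
          by_contra hc
          exact hmin m (by omega) hm
        rcases h' with h' | h' | h'
        · exact Or.inl (Or.inl h')
        · exact Or.inl (Or.inr h')
        · exact Or.inr fun r' hr' => ⟨n, hnm, h' r' hr'⟩
  · exact ⟨(u, v), hu, hv, fun n hn => absurd ⟨n, hn⟩ h⟩

theorem copsWin_of_win {G : SimpleGraph V} (hnb : ∀ v, ∃ u, G.Adj v u) {p q : V}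
    (hw : ∀ r, Win G p q r) : ActiveCopsWin G 2 := by
  choose mv hm1 hm2 hm3 using exists_move hnb
  refine ⟨⟨![p, q], fun _ c => ![(mv (c.1 0) (c.1 1) c.2).1, (mv (c.1 0) (c.1 1) c.2).2], ?_⟩, ?_⟩
  · intro _ c i
    fin_cases i
    · exact hm1 _ _ _
    · exact hm2 _ _ _
  · intro rs
    unfold ActiveCapture crCaptures
    set cmove : List (CRConfig V 2) → CRConfig V 2 → Fin 2 → V :=
      fun _ c => ![(mv (c.1 0) (c.1 1) c.2).1, (mv (c.1 0) (c.1 1) c.2).2] with hcm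
    set P := crPlay 2 ![p, q] rs.init cmove rs.move with hP
    have key : ∀ n t, WinIn G n ((P t).2.1 0) ((P t).2.1 1) (P t).2.2 →
        ∃ t, (∃ i, (P t).2.1 i = (P t).2.2) ∨ (∃ i, cmove (P t).1 (P t).2 i = (P t).2.2) := by
      intro n
      induction n using Nat.strong_induction_on with
      | _ n ih =>
      intro t ht
      rcases hm3 _ _ _ n ht with (h | h) | (h | h) | h
      · exact ⟨t, Or.inl ⟨0, h⟩⟩
      · exact ⟨t, Or.inl ⟨1, h⟩⟩
      · exact ⟨t, Or.inr ⟨0, h⟩⟩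
      · exact ⟨t, Or.inr ⟨1, h⟩⟩
      · obtain ⟨k, hk, hk'⟩ := h (P (t + 1)).2.2 (rs.move_adj (P t).1 (cmove (P t).1 (P t).2, (P t).2.2))
        exact ih k hk (t + 1) hk'
    obtain ⟨n, hn⟩ := hw (rs.init ![p, q])
    exact key n 0 hn

end Helpers

/-- If `G` is a connected outerplanar graph, then `acop(G) ≤ 2`. -/
theorem acop_le_two_of_outerplanar {V : Type u} [Fintype V]
    (G : SimpleGraph V) (hconn : G.Connected) (hout : Outerplanar G) :
    acop G ≤ 2 := by
  obtain ⟨v0⟩ := hconn.nonempty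
  rcases subsingleton_or_nontrivial V with hV | hV
  · have h0 : ActiveCopsWin G 0 := by
      refine ⟨⟨fun i => i.elim0, fun _ _ i => i.elim0, fun _ _ i => i.elim0⟩, fun rs => ?_⟩
      exact absurd (Subsingleton.elim _ _) (rs.move_adj [] (fun i => i.elim0, v0)).ne
    exact (Nat.sInf_le h0).trans (by norm_num)
  · have hnb : ∀ v, ∃ u, G.Adj v u := fun v => hconn.preconnected.exists_adj_of_nontrivial v
    obtain ⟨u, hu⟩ := hnb v0
    exact Nat.sInf_le (copsWin_of_win hnb (win_init hconn hout hnb hu))
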